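/- Let d : ℕ → ℕ satisfy d i ≥ 2 for all i, let V be the vertex set of the spherically homogeneous rooted tree with branching sequence d, and let G be a group acting on V by rooted-tree automorphisms, spherically transitively. Suppose some vertex v₀ has nontrivial subtree stabilizer: there exists g₀ ∈ G with g₀ ≠ 1 such that g₀ • w = w for every w with v₀ ≼ w. Then the action is not locally somewhere free: there exists a finite subset F ⊆ G with 1 ∉ F such that every vertex of V is fixed by at least one element of F. -/

import Mathlib

/-- Vertex set of the spherically homogeneous rooted tree with branching sequence `d`:
a vertex of level `n` is a word `x : Π i : Fin n, Fin (d i)`. -/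
def TreeVertex (d : ℕ → ℕ) : Type := Σ n : ℕ, (∀ i : Fin n, Fin (d i))

/-- `IsAncestor v w` : the vertex `v` is an ancestor of `w` (i.e. `w` belongs to the
subtree rooted at `v`). -/
def IsAncestor {d : ℕ → ℕ} (v w : TreeVertex d) : Prop :=
  ∃ h : v.1 ≤ w.1, ∀ i : Fin v.1, v.2 i = w.2 (Fin.castLE h i)

/-- Two ancestors of a vertex on the same level coincide. -/
theorem IsAncestor.eq_of_level_eq {d : ℕ → ℕ} {u v w : TreeVertex d}
    (hu : IsAncestor u w) (hv : IsAncestor v w) (huv : u.1 = v.1) : u = v := by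
  obtain ⟨m, x⟩ := u
  obtain ⟨n, y⟩ := v
  obtain rfl : m = n := huv
  obtain ⟨_, hx⟩ := hu
  obtain ⟨_, hy⟩ := hv
  have hxy : x = y := funext fun i => (hx i).trans (hy i).symm
  rw [hxy]

/-- If all branching numbers are positive, every vertex has a descendant on every level below. -/
theorem exists_isAncestor_level_eq {d : ℕ → ℕ} (hd : ∀ i, 0 < d i) (v : TreeVertex d) {n : ℕ}
    (hn : v.1 ≤ n) : ∃ w : TreeVertex d, w.1 = n ∧ IsAncestor v w := by
  refine ⟨⟨n, fun i => if h : (i : ℕ) < v.1 then v.2 ⟨i, h⟩ else ⟨0, hd i⟩⟩, rfl, hn, fun i => ?_⟩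
  simp

/-- Every vertex has an ancestor on every level above it. -/
theorem exists_level_isAncestor {d : ℕ → ℕ} (w : TreeVertex d) {n : ℕ} (hn : n ≤ w.1) :
    ∃ x : (∀ i : Fin n, Fin (d i)), IsAncestor ⟨n, x⟩ w :=
  ⟨fun i => w.2 (Fin.castLE hn i), hn, fun _ => rfl⟩


/-- If a spherically transitive action by rooted-tree automorphisms has some nontrivial
subtree stabilizer, then the action is not locally somewhere free: there is a finite set
`F ⊆ G` of nontrivial elements such that every vertex is fixed by some element of `F`. -/
theorem nontrivial_subtree_stabilizer_imp_not_lsf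
    (d : ℕ → ℕ) (hd : ∀ i, 2 ≤ d i)
    (G : Type*) [Group G] [MulAction G (TreeVertex d)]
    (hlevel : ∀ (g : G) (v : TreeVertex d), (g • v).1 = v.1)
    (hanc : ∀ (g : G) (v w : TreeVertex d), IsAncestor v w → IsAncestor (g • v) (g • w))
    (htrans : ∀ v w : TreeVertex d, v.1 = w.1 → ∃ g : G, g • v = w)
    (v₀ : TreeVertex d) (g₀ : G) (hg₀ : g₀ ≠ 1)
    (hfix : ∀ w, IsAncestor v₀ w → g₀ • w = w) :
    ∃ F : Finset G, (1 : G) ∉ F ∧ ∀ v : TreeVertex d, ∃ g ∈ F, g • v = v := by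
  classical
  choose t ht using fun x : (∀ i : Fin v₀.1, Fin (d i)) => htrans v₀ ⟨v₀.1, x⟩ rfl
  refine ⟨Finset.univ.image fun x => t x * g₀ * (t x)⁻¹, ?_, fun v => ?_⟩
  · simpa [conj_eq_one_iff] using fun _ => hg₀
  · obtain ⟨w, hw, hvw⟩ := exists_isAncestor_level_eq (fun i => two_pos.trans_le (hd i)) v
      (le_max_left v.1 v₀.1)
    obtain ⟨x, hx⟩ := exists_level_isAncestor w (n := v₀.1) (hw ▸ le_max_right _ _)
    refine ⟨t x * g₀ * (t x)⁻¹, Finset.mem_image_of_mem _ (Finset.mem_univ x), ?_⟩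
    have hv₀ : IsAncestor v₀ ((t x)⁻¹ • w) := by
      have h := hanc (t x)⁻¹ _ _ hx
      rwa [← ht x, inv_smul_smul] at h
    have hwfix : (t x * g₀ * (t x)⁻¹) • w = w := by
      rw [mul_smul, mul_smul, hfix _ hv₀, smul_inv_smul]
    have hgv := hanc (t x * g₀ * (t x)⁻¹) _ _ hvw
    rw [hwfix] at hgv
    exact hgv.eq_of_level_eq hvw (hlevel _ v)
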